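/- arXiv:2208.03533 — 10 statements merged into one kernel-verified Lean document; each statement's English description precedes it below -/
import Mathlib

section
/- A pair (u, v) with u > 0 and v > 0 satisfies N1(u,v) = 0 and N2(u,v) = 0 if and only if u is a root of the cubic φ(u) = α·η·u³ − α·κ·η·u² − κ·u + κ and v = (1 − u)/(α·u); moreover, in that case necessarily 0 < u < 1. -/
/-- Prey equation: N1(u,v) = η·u·(1 − u/κ) − (1+α·v)·u·v -/
noncomputable def N1 (eta kap alp u v : ℝ) : ℝ := eta * u * (1 - u / kap) - (1 + alp * v) * u * v

/-- Predator equation: N2(u,v) = (1+α·v)·u·v − v -/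
noncomputable def N2 (alp u v : ℝ) : ℝ := (1 + alp * v) * u * v - v

/-- A positive pair (u,v) is an equilibrium iff u is a root of the cubic φ and
v = (1−u)/(α·u); moreover in that case 0 < u < 1. -/
theorem coexisting_equilibrium_iff_cubic_root (eta kap alp u v : ℝ)
    (heta : 0 < eta) (hkap : 0 < kap) (halp : 0 < alp)
    (hu : 0 < u) (hv : 0 < v) :
    ((N1 eta kap alp u v = 0 ∧ N2 alp u v = 0) ↔
      (alp * eta * u ^ 3 - alp * kap * eta * u ^ 2 - kap * u + kap = 0 ∧
        v = (1 - u) / (alp * u))) ∧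
    ((N1 eta kap alp u v = 0 ∧ N2 alp u v = 0) → 0 < u ∧ u < 1) := by
  have h2 : N2 alp u v = 0 ↔ (1 + alp * v) * u = 1 := by
    unfold N2
    constructor
    · intro h
      apply mul_right_cancel₀ hv.ne'
      linarith
    · intro h
      rw [h]
      ring
  have h3 : v = (1 - u) / (alp * u) ↔ (1 + alp * v) * u = 1 := by
    rw [eq_div_iff (by positivity)]
    constructor <;> intro h <;> linarith
  have key : (1 + alp * v) * u = 1 →
      alp * eta * u ^ 3 - alp * kap * eta * u ^ 2 - kap * u + kap
        = -(alp * u * kap) * N1 eta kap alp u v := by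
    intro h
    have hk : kap * (u / kap) = u := by field_simp
    unfold N1
    linear_combination (-kap - alp * u * kap * v) * h - alp * eta * u ^ 2 * hk
  have hne : -(alp * u * kap) ≠ 0 := neg_ne_zero.mpr (by positivity)
  refine ⟨?_, ?_⟩
  · rw [h2, h3]
    constructor
    · rintro ⟨h, h'⟩
      exact ⟨by rw [key h', h, mul_zero], h'⟩
    · rintro ⟨h, h'⟩
      rw [key h'] at h
      exact ⟨(mul_eq_zero.mp h).resolve_left hne, h'⟩
  · rintro ⟨_, h⟩
    have h' := h2.mp h
    have : 0 < alp * v * u := by positivity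
    exact ⟨hu, by linarith⟩
end

section
/- If κ > 1, then the cubic φ(u) = α·η·u³ − α·κ·η·u² − κ·u + κ has exactly one root u in the open interval (0, 1); consequently the temporal model has a unique coexisting equilibrium. -/
/-- Two roots of the cubic in the unit interval cannot be strictly ordered. -/
theorem cubic_roots_not_lt (eta kap alp u w : ℝ) (heta : 0 < eta) (hkap : 1 < kap)
    (halp : 0 < alp) (hu0 : 0 < u) (hw1 : w < 1)
    (hu : alp * eta * u ^ 3 - alp * kap * eta * u ^ 2 - kap * u + kap = 0)
    (hw : alp * eta * w ^ 3 - alp * kap * eta * w ^ 2 - kap * w + kap = 0) : ¬ u < w := by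
  intro h
  have h1 : (kap - u) * (1 - w) < (kap - w) * (1 - u) := by
    nlinarith [mul_pos (sub_pos.2 hkap) (sub_pos.2 h)]
  have h2 : u ^ 2 < w ^ 2 := by nlinarith
  have h3 : 0 < (kap - u) * (1 - w) := mul_pos (by linarith) (by linarith)
  have h4 : u ^ 2 * ((kap - u) * (1 - w)) < w ^ 2 * ((kap - w) * (1 - u)) :=
    mul_lt_mul'' h2 h1 (by positivity) h3.le
  have h5 : (alp * eta) * (u ^ 2 * ((kap - u) * (1 - w)))
      = (alp * eta) * (w ^ 2 * ((kap - w) * (1 - u))) := by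
    linear_combination (-(1 - w)) * hu + (1 - u) * hw
  have h6 := mul_lt_mul_of_pos_left h4 (mul_pos halp heta)
  linarith

/-- If κ > 1 the cubic φ has exactly one root in (0,1); consequently the temporal
model has a unique coexisting equilibrium. -/
theorem unique_coexisting_equilibrium_of_kappa_gt_one (eta kap alp : ℝ)
    (heta : 0 < eta) (hkap : 1 < kap) (halp : 0 < alp) :
    (∃! u : ℝ, u ∈ Set.Ioo (0 : ℝ) 1 ∧
      alp * eta * u ^ 3 - alp * kap * eta * u ^ 2 - kap * u + kap = 0) ∧
    (∃! p : ℝ × ℝ, 0 < p.1 ∧ 0 < p.2 ∧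
      N1 eta kap alp p.1 p.2 = 0 ∧ N2 alp p.1 p.2 = 0) := by
  have hk : kap ≠ 0 := by linarith
  have uniq : ∀ u w : ℝ, 0 < u → u < 1 → 0 < w → w < 1 →
      alp * eta * u ^ 3 - alp * kap * eta * u ^ 2 - kap * u + kap = 0 →
      alp * eta * w ^ 3 - alp * kap * eta * w ^ 2 - kap * w + kap = 0 → u = w := by
    intro u w hu0 hu1 hw0 hw1 hu hw
    exact le_antisymm
      (not_lt.1 (cubic_roots_not_lt eta kap alp w u heta hkap halp hw0 hu1 hw hu))
      (not_lt.1 (cubic_roots_not_lt eta kap alp u w heta hkap halp hu0 hw1 hu hw))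
  have ex : ∃ u : ℝ, u ∈ Set.Ioo (0 : ℝ) 1 ∧
      alp * eta * u ^ 3 - alp * kap * eta * u ^ 2 - kap * u + kap = 0 := by
    have hc : ContinuousOn
        (fun u : ℝ => alp * eta * u ^ 3 - alp * kap * eta * u ^ 2 - kap * u + kap)
        (Set.Icc 0 1) := by fun_prop
    have hi := intermediate_value_Ioo' (zero_le_one' ℝ) hc
    have hm : (0 : ℝ) ∈ Set.Ioo
        (alp * eta * (1 : ℝ) ^ 3 - alp * kap * eta * 1 ^ 2 - kap * 1 + kap)
        (alp * eta * (0 : ℝ) ^ 3 - alp * kap * eta * 0 ^ 2 - kap * 0 + kap) := by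
      constructor
      · nlinarith [mul_pos (mul_pos halp heta) (sub_pos.2 hkap)]
      · nlinarith
    obtain ⟨u, hu, he⟩ := hi hm
    exact ⟨u, hu, he⟩
  obtain ⟨u, ⟨hu0, hu1⟩, hu⟩ := ex
  have hv : 0 < (1 - u) / (alp * u) := div_pos (by linarith) (by positivity)
  refine ⟨⟨u, ⟨⟨hu0, hu1⟩, hu⟩, ?_⟩, ⟨(u, (1 - u) / (alp * u)), ⟨hu0, hv, ?_, ?_⟩, ?_⟩⟩
  · rintro w ⟨⟨hw0, hw1⟩, hw⟩
    exact uniq w u hw0 hw1 hu0 hu1 hw hu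
  · have hne := hu0.ne'
    have hane := halp.ne'
    simp only [N1]
    field_simp
    linear_combination -hu
  · have hne := hu0.ne'
    have hane := halp.ne'
    simp only [N2]
    field_simp
    ring
  · rintro ⟨w, v⟩ ⟨hw0, hv0, h1, h2⟩
    simp only [N1, N2] at hw0 hv0 h1 h2
    have h3 : (1 + alp * v) * w = 1 := by
      apply mul_right_cancel₀ hv0.ne'
      linarith
    have hp : 0 < alp * v * w := by positivity
    have hw1 : w < 1 := by nlinarith
    have h4 : eta * w * (kap - w) = kap * v := by
      have h5 : eta * w * (1 - w / kap) = v := by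
        linear_combination h1 + v * h3
      rw [← h5]
      field_simp
    have hw : alp * eta * w ^ 3 - alp * kap * eta * w ^ 2 - kap * w + kap = 0 := by
      linear_combination (-alp * w) * h4 - kap * h3
    have hwu := uniq w u hw0 hw1 hu0 hu1 hw hu
    subst hwu
    have : v = (1 - w) / (alp * w) := by
      rw [eq_div_iff (by positivity)]
      linear_combination h3
    rw [this]
end

section
/- Let (u*, v*) be a coexisting equilibrium. If α·κ·v* < η and κ·(1+α·v*)·(1+2α·v*) > η·α·u*, then the trace of J* is negative and the determinant of J* is positive, and consequently every complex root λ of the characteristic polynomial of J* satisfies Re(λ) < 0 (local asymptotic stability of (u*, v*)). -/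
/-- The Jacobian matrix J* of the temporal model at a coexisting equilibrium. -/
noncomputable def Jstar (eta kap alp u v : ℝ) : Matrix (Fin 2) (Fin 2) ℝ :=
  !![-eta * u / kap, -(1 + 2 * alp * v) * u; (1 + alp * v) * v, alp * u * v]

/-- If α·κ·v* < η and κ·(1+α·v*)·(1+2α·v*) > η·α·u*, then trace(J*) < 0, det(J*) > 0,
and every complex root λ of the characteristic polynomial of J* has Re(λ) < 0. -/
theorem coexisting_equilibrium_locally_asymptotically_stable (eta kap alp u v : ℝ)
    (heta : 0 < eta) (hkap : 0 < kap) (halp : 0 < alp)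
    (hu : 0 < u) (hv : 0 < v)
    (heq1 : N1 eta kap alp u v = 0) (heq2 : N2 alp u v = 0)
    (hcond1 : alp * kap * v < eta)
    (hcond2 : kap * (1 + alp * v) * (1 + 2 * alp * v) > eta * alp * u) :
    Matrix.trace (Jstar eta kap alp u v) < 0 ∧
    0 < Matrix.det (Jstar eta kap alp u v) ∧
    ∀ lam : ℂ,
      (((Jstar eta kap alp u v).map (algebraMap ℝ ℂ)).charpoly).IsRoot lam →
        lam.re < 0 := by
  have htr : Matrix.trace (Jstar eta kap alp u v) < 0 := by
    have h : Matrix.trace (Jstar eta kap alp u v) = (u / kap) * (alp * kap * v - eta) := by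
      simp only [Jstar, Matrix.trace_fin_two_of]
      field_simp
      ring
    rw [h]
    exact mul_neg_of_pos_of_neg (by positivity) (by linarith)
  have hdet : 0 < Matrix.det (Jstar eta kap alp u v) := by
    have h : Matrix.det (Jstar eta kap alp u v) =
        (u * v / kap) * (kap * (1 + alp * v) * (1 + 2 * alp * v) - eta * alp * u) := by
      simp only [Jstar, Matrix.det_fin_two_of]
      field_simp
      ring
    rw [h]
    exact mul_pos (by positivity) (by linarith)
  refine ⟨htr, hdet, ?_⟩
  intro lam hroot
  generalize Jstar eta kap alp u v = J at htr hdet hroot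
  rw [Matrix.charpoly_map, Polynomial.IsRoot.def, Matrix.charpoly_fin_two] at hroot
  generalize J.trace = T at htr hroot
  generalize J.det = D at hdet hroot
  simp only [Polynomial.map_add, Polynomial.map_sub, Polynomial.map_mul, Polynomial.map_pow,
    Polynomial.map_X, Polynomial.map_C, Polynomial.eval_add, Polynomial.eval_sub,
    Polynomial.eval_mul, Polynomial.eval_pow, Polynomial.eval_X, Polynomial.eval_C,
    Complex.coe_algebraMap] at hroot
  have hre := congrArg Complex.re hroot
  have him := congrArg Complex.im hroot
  simp [pow_two] at hre him
  by_contra hx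
  have hx : 0 ≤ lam.re := not_lt.mp hx
  have hy : lam.im * (2 * lam.re - T) = 0 := by linarith
  rcases mul_eq_zero.mp hy with hy | hy
  · rw [hy] at hre
    nlinarith [mul_nonneg hx (neg_nonneg.mpr htr.le), mul_self_nonneg lam.re]
  · linarith
end

section
/- Let (u*, v*) be a coexisting equilibrium. Then det(J*) = 0 if and only if η = κ·(2 − u*)/(α·u*³); this identifies the saddle-node bifurcation threshold η_SN = κ·(2 − u*)/(α·u*³). -/
/-- At a coexisting equilibrium, det(J*) = 0 iff η = κ·(2 − u*)/(α·u*³): the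
saddle-node bifurcation threshold η_SN. -/
theorem saddle_node_threshold (eta kap alp u v : ℝ)
    (heta : 0 < eta) (hkap : 0 < kap) (halp : 0 < alp)
    (hu : 0 < u) (hv : 0 < v)
    (heq1 : N1 eta kap alp u v = 0) (heq2 : N2 alp u v = 0) :
    Matrix.det (Jstar eta kap alp u v) = 0 ↔ eta = kap * (2 - u) / (alp * u ^ 3) := by
  have h2 : (1 + alp * v) * u = 1 := by
    unfold N2 at heq2
    have h : v * ((1 + alp * v) * u - 1) = 0 := by linarith
    rcases mul_eq_zero.mp h with h | h
    · exact absurd h hv.ne'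
    · linarith
  have hdet : Matrix.det (Jstar eta kap alp u v)
      = v * (kap * (2 - u) - eta * (alp * u ^ 3)) / (kap * u) := by
    rw [Jstar, Matrix.det_fin_two_of]
    field_simp
    linear_combination (kap * u * (1 + 2 * alp * v) + 2 * kap) * h2
  have hk : kap * u ≠ 0 := by positivity
  have ha : alp * u ^ 3 ≠ 0 := by positivity
  rw [hdet, div_eq_zero_iff, eq_div_iff ha, mul_eq_zero]
  constructor
  · rintro ((h | h) | h)
    · exact absurd h hv.ne'
    · linarith
    · exact absurd h hk
  · intro h
    left
    right
    linarith
end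

section
/- Let (u*, v*) be a coexisting equilibrium satisfying the Bogdanov-Takens conditions α·κ·v* = η and α·η·u*³ = κ·(2 − u*). Then trace(J*) = 0 and det(J*) = 0, the matrix J* is nonzero with J*² = 0 (a nonzero nilpotent matrix of index two), and hence J* is similar to the Jordan block [[0, 1], [0, 0]]; in particular 0 is an eigenvalue of J* of algebraic multiplicity two. -/
theorem aux_nilp (a b c : ℝ) (hc : 0 < c) (h : a * a = b * c) (J : Matrix (Fin 2) (Fin 2) ℝ)
    (hJ : J = !![-a, -b; c, a]) :
    Matrix.trace J = 0 ∧ Matrix.det J = 0 ∧ J ≠ 0 ∧ J * J = 0 ∧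
    (∃ P : Matrix (Fin 2) (Fin 2) ℝ, IsUnit P.det ∧ J = P * !![0, 1; 0, 0] * P⁻¹) ∧
    J.charpoly = Polynomial.X ^ 2 := by
  have ht : Matrix.trace J = 0 := by
    rw [hJ, Matrix.trace_fin_two]; simp
  have hd : Matrix.det J = 0 := by
    rw [hJ, Matrix.det_fin_two_of]; linarith
  have hsq : J * J = 0 := by
    rw [hJ]
    ext i j
    fin_cases i <;> fin_cases j <;> simp [Matrix.mul_apply, Fin.sum_univ_two] <;> linarith
  refine ⟨ht, hd, ?_, hsq, ?_, ?_⟩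
  · intro h0
    have h1 : J 1 0 = 0 := by rw [h0]; rfl
    rw [hJ] at h1
    have h2 : c = 0 := h1
    exact hc.ne' h2
  · have hP : IsUnit (!![-a, 1; c, 0] : Matrix (Fin 2) (Fin 2) ℝ).det := by
      rw [Matrix.det_fin_two_of]
      simp [hc.ne']
    refine ⟨!![-a, 1; c, 0], hP, ?_⟩
    have key : !![-a, 1; c, 0] * !![0, 1; 0, 0] = J * !![-a, 1; c, 0] := by
      rw [hJ]
      ext i j
      fin_cases i <;> fin_cases j <;> simp [Matrix.mul_apply, Fin.sum_univ_two] <;> linarith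
    rw [key, Matrix.mul_nonsing_inv_cancel_right _ _ hP]
  · rw [Matrix.charpoly_fin_two, ht, hd]; simp

/-- Under the Bogdanov-Takens conditions α·κ·v* = η and α·η·u*³ = κ·(2 − u*),
trace(J*) = 0, det(J*) = 0, J* is a nonzero nilpotent matrix of index two, J* is
similar to the Jordan block [[0,1],[0,0]], and 0 is an eigenvalue of algebraic
multiplicity two (charpoly J* = X²). -/
theorem bogdanov_takens_nilpotent_jacobian (eta kap alp u v : ℝ)
    (heta : 0 < eta) (hkap : 0 < kap) (halp : 0 < alp)
    (hu : 0 < u) (hv : 0 < v)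
    (heq1 : N1 eta kap alp u v = 0) (heq2 : N2 alp u v = 0)
    (hBT1 : alp * kap * v = eta) (hBT2 : alp * eta * u ^ 3 = kap * (2 - u)) :
    Matrix.trace (Jstar eta kap alp u v) = 0 ∧
    Matrix.det (Jstar eta kap alp u v) = 0 ∧
    Jstar eta kap alp u v ≠ 0 ∧
    Jstar eta kap alp u v * Jstar eta kap alp u v = 0 ∧
    (∃ P : Matrix (Fin 2) (Fin 2) ℝ, IsUnit P.det ∧
      Jstar eta kap alp u v = P * !![0, 1; 0, 0] * P⁻¹) ∧
    (Jstar eta kap alp u v).charpoly = Polynomial.X ^ 2 := by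
  have hJe : Jstar eta kap alp u v =
      !![-(alp * u * v), -((1 + 2 * alp * v) * u); (1 + alp * v) * v, alp * u * v] := by
    have e1 : -eta * u / kap = -(alp * u * v) := by
      rw [← hBT1]; field_simp
    unfold Jstar
    rw [e1, neg_mul]
  have h1 : (1 + alp * v) * u = 1 := by
    unfold N2 at heq2
    apply mul_right_cancel₀ hv.ne'
    linarith
  have h2 : alp ^ 2 * v * u ^ 3 = 2 - u := by
    apply mul_left_cancel₀ hkap.ne'
    rw [← hBT2, ← hBT1]; ring
  have h3 : (1 + 2 * alp * v) * u = 2 - u := by linarith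
  refine aux_nilp _ _ _ (by positivity) ?_ _ hJe
  rw [h3, ← h2]
  linear_combination (-(alp ^ 2 * v ^ 2 * u ^ 2)) * h1
end

section
/- Let (u*, v*) be a coexisting equilibrium, and set z = (1, −(1+α·v*)/(α·u*)) and w = (1, (1+2α·v*)/(α·v*)). Then the saddle-node transversality quantities satisfy the explicit identities: (i) wᵀ·(∂F/∂η)(u*, v*) = u*·(1 − u*/κ), where ∂F/∂η = (u·(1 − u/κ), 0); and (ii) wᵀ·[D²F(u*, v*)(z, z)] = −2η/κ − 2(1+α·v*)/(α·u*²). -/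
theorem iteratedDeriv_two_cubic (a b c d : ℝ) :
    iteratedDeriv 2 (fun t : ℝ => a + b * t + c * t ^ 2 + d * t ^ 3) 0 = 2 * c := by
  have h1 : deriv (fun t : ℝ => a + b * t + c * t ^ 2 + d * t ^ 3)
      = fun t : ℝ => b + 2 * c * t + 3 * d * t ^ 2 := by
    funext t
    have h := (((hasDerivAt_const t a).add ((hasDerivAt_id t).const_mul b)).add
      ((hasDerivAt_pow 2 t).const_mul c)).add ((hasDerivAt_pow 3 t).const_mul d)
    refine HasDerivAt.deriv (h.congr_deriv ?_)
    norm_num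
    ring
  have h2 : HasDerivAt (fun t : ℝ => b + 2 * c * t + 3 * d * t ^ 2) (2 * c) 0 := by
    have h := ((hasDerivAt_const (0 : ℝ) b).add ((hasDerivAt_id (0 : ℝ)).const_mul (2 * c))).add
      ((hasDerivAt_pow 2 (0 : ℝ)).const_mul (3 * d))
    refine h.congr_deriv ?_
    norm_num
  rw [iteratedDeriv_succ, iteratedDeriv_one, h1, h2.deriv]

/-- Saddle-node transversality identities at a coexisting equilibrium, with
z = (1, −(1+α·v*)/(α·u*)) and w = (1, (1+2α·v*)/(α·v*)):
(i) wᵀ·(∂F/∂η)(u*,v*) = u*·(1 − u*/κ), where ∂F/∂η = (u·(1 − u/κ), 0);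
(ii) wᵀ·[D²F(u*,v*)(z,z)] = −2η/κ − 2(1+α·v*)/(α·u*²), where the components of
D²F(p)(z,z) are the second directional derivatives of N1 and N2 along z. -/
theorem saddle_node_transversality (eta kap alp u v : ℝ)
    (heta : 0 < eta) (hkap : 0 < kap) (halp : 0 < alp)
    (hu : 0 < u) (hv : 0 < v)
    (heq1 : N1 eta kap alp u v = 0) (heq2 : N2 alp u v = 0) :
    (1 * (u * (1 - u / kap)) + ((1 + 2 * alp * v) / (alp * v)) * 0 = u * (1 - u / kap)) ∧
    (1 * iteratedDeriv 2
        (fun t : ℝ => N1 eta kap alp (u + t * 1) (v + t * (-(1 + alp * v) / (alp * u)))) 0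
      + ((1 + 2 * alp * v) / (alp * v)) * iteratedDeriv 2
        (fun t : ℝ => N2 alp (u + t * 1) (v + t * (-(1 + alp * v) / (alp * u)))) 0
      = -2 * eta / kap - 2 * (1 + alp * v) / (alp * u ^ 2)) := by
  refine ⟨by ring, ?_⟩
  have hz : alp * u * (-(1 + alp * v) / (alp * u)) = -(1 + alp * v) := by
    field_simp
  have hr : -2 * eta / kap - 2 * (1 + alp * v) / (alp * u ^ 2)
      = -2 * eta / kap + 2 * (1 + alp * v) * (-(1 + alp * v) / (alp * u)) := by
    have h : (1 + alp * v) * u = 1 := by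
      unfold N2 at heq2
      have : v * ((1 + alp * v) * u - 1) = 0 := by linarith
      rcases mul_eq_zero.mp this with h | h
      · exact absurd h hv.ne'
      · linarith
    field_simp
    linear_combination (kap * (1 + alp * v)) * h
  rw [hr]
  generalize -(1 + alp * v) / (alp * u) = z at hz ⊢
  have e2 : (fun t : ℝ => N2 alp (u + t * 1) (v + t * z)) = fun t : ℝ =>
      ((1 + alp * v) * u * v - v) + (v + u * z + alp * v ^ 2 + 2 * alp * u * v * z - z) * t
        + (z + 2 * alp * v * z + alp * u * z ^ 2) * t ^ 2 + (alp * z ^ 2) * t ^ 3 := by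
    funext t
    unfold N2
    ring
  have e1 : (fun t : ℝ => N1 eta kap alp (u + t * 1) (v + t * z)) = fun t : ℝ =>
      (eta * u * (1 - u / kap) - (1 + alp * v) * u * v)
        + (eta - 2 * eta * u / kap - (v + u * z + alp * v ^ 2 + 2 * alp * u * v * z)) * t
        + (- eta / kap - (z + 2 * alp * v * z + alp * u * z ^ 2)) * t ^ 2
        + (- (alp * z ^ 2)) * t ^ 3 := by
    funext t
    unfold N1
    ring
  have hG : z + 2 * alp * v * z + alp * u * z ^ 2 = alp * v * z := by
    linear_combination z * hz
  rw [e1, e2, iteratedDeriv_two_cubic, iteratedDeriv_two_cubic, hG]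
  field_simp
  ring
end

section
/- Let a11, a22 be real numbers and b > 0, d ≥ 0, σ ∈ ℝ, and define T(k) = a11 − b·exp(−σ²·k²/2) + a22 − (1 + d)·k². If a11 − b + a22 < 0 and b·σ²/2 ≤ 1 + d, then T(k) < 0 for every real k. -/
/-- If a11 − b + a22 < 0 and b·σ²/2 ≤ 1 + d, then the trace
T(k) = a11 − b·exp(−σ²·k²/2) + a22 − (1+d)·k² is negative for every real k. -/
theorem trace_negative_for_all_wavenumbers (a11 a22 b d sigma : ℝ)
    (hb : 0 < b) (hd : 0 ≤ d)
    (h1 : a11 - b + a22 < 0) (h2 : b * sigma ^ 2 / 2 ≤ 1 + d) :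
    ∀ k : ℝ, a11 - b * Real.exp (-sigma ^ 2 * k ^ 2 / 2) + a22 - (1 + d) * k ^ 2 < 0 := by
  intro k
  have e := mul_le_mul_of_nonneg_left (Real.add_one_le_exp (-sigma ^ 2 * k ^ 2 / 2)) hb.le
  have g := mul_le_mul_of_nonneg_right h2 (sq_nonneg k)
  linarith
end

section
/- Let a11, a12, a21, a22, b, d, σ be real numbers, let E(k) = exp(−σ²·k²/2), P(k) = a11 − b·E(k) − k², and D(k) = P(k)·(a22 − d·k²) − a12·a21. If k > 0 satisfies D(k) = 0 and D′(k) = 0 (derivative in k), then the eliminated Turing equation holds: 2·a22·P(k)² − a12·a21·(2·a11 − 4·k² − b·(2 − σ²·k²)·E(k)) = 0. -/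
/-- Eliminating the diffusion coefficient d between D(k) = 0 and D′(k) = 0, where
E(k) = exp(−σ²k²/2), P(k) = a11 − b·E(k) − k², and D(k) = P(k)·(a22 − d·k²) − a12·a21,
yields 2·a22·P(k)² − a12·a21·(2·a11 − 4·k² − b·(2 − σ²·k²)·E(k)) = 0. -/
theorem turing_wavenumber_equation (a11 a12 a21 a22 b d sigma k : ℝ) (hk : 0 < k)
    (hD : (a11 - b * Real.exp (-sigma ^ 2 * k ^ 2 / 2) - k ^ 2) * (a22 - d * k ^ 2)
        - a12 * a21 = 0)
    (hD' : deriv (fun x : ℝ =>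
        (a11 - b * Real.exp (-sigma ^ 2 * x ^ 2 / 2) - x ^ 2) * (a22 - d * x ^ 2)
          - a12 * a21) k = 0) :
    2 * a22 * (a11 - b * Real.exp (-sigma ^ 2 * k ^ 2 / 2) - k ^ 2) ^ 2
      - a12 * a21 * (2 * a11 - 4 * k ^ 2
          - b * (2 - sigma ^ 2 * k ^ 2) * Real.exp (-sigma ^ 2 * k ^ 2 / 2)) = 0 := by
  have h1 : HasDerivAt (fun x : ℝ => x ^ 2) (2 * k) k := by
    simpa using hasDerivAt_pow 2 k
  have h2 : HasDerivAt (fun x : ℝ => Real.exp (-sigma ^ 2 * x ^ 2 / 2))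
      (Real.exp (-sigma ^ 2 * k ^ 2 / 2) * (-sigma ^ 2 * (2 * k) / 2)) k :=
    ((h1.const_mul (-sigma ^ 2)).div_const 2).exp
  have h3 := ((((h2.const_mul b).const_sub a11).sub h1).mul
    ((h1.const_mul d).const_sub a22)).sub_const (a12 * a21)
  have h4 := h3.deriv.symm.trans hD'
  simp only [Pi.sub_apply] at h4
  generalize Real.exp (-sigma ^ 2 * k ^ 2 / 2) = E at *
  linear_combination (-(a11 - b * E - k ^ 2) * k) * h4
    + (2 * a11 - 4 * k ^ 2 - b * (2 - sigma ^ 2 * k ^ 2) * E) * hD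
end

section
/- Suppose m1 > 0 and μ > 0. Then the stripe point (√(μ/m1), 0, 0) is an equilibrium of the amplitude system, and the eigenvalues of the Jacobian W there are exactly −2μ, μ·(1 − m2/m1) + |h0|·√(μ/m1), and μ·(1 − m2/m1) − |h0|·√(μ/m1). Moreover all three eigenvalues are negative if and only if m2 > m1 and μ > h0²·m1/(m2 − m1)². -/
/-- First component of the amplitude system vector field. -/
noncomputable def G1 (mu h0 m1 m2 a b c : ℝ) : ℝ :=
  mu * a + |h0| * b * c - m1 * a ^ 3 - m2 * (b ^ 2 + c ^ 2) * a

/-- Second component of the amplitude system vector field. -/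
noncomputable def G2 (mu h0 m1 m2 a b c : ℝ) : ℝ :=
  mu * b + |h0| * a * c - m1 * b ^ 3 - m2 * (a ^ 2 + c ^ 2) * b

/-- Third component of the amplitude system vector field. -/
noncomputable def G3 (mu h0 m1 m2 a b c : ℝ) : ℝ :=
  mu * c + |h0| * a * b - m1 * c ^ 3 - m2 * (a ^ 2 + b ^ 2) * c

/-- The Jacobian matrix W of the amplitude system at (a,b,c), given by the matrix
of partial derivatives of (G1, G2, G3). -/
noncomputable def W (mu h0 m1 m2 a b c : ℝ) : Matrix (Fin 3) (Fin 3) ℝ :=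
  !![deriv (fun x => G1 mu h0 m1 m2 x b c) a, deriv (fun y => G1 mu h0 m1 m2 a y c) b,
       deriv (fun z => G1 mu h0 m1 m2 a b z) c;
     deriv (fun x => G2 mu h0 m1 m2 x b c) a, deriv (fun y => G2 mu h0 m1 m2 a y c) b,
       deriv (fun z => G2 mu h0 m1 m2 a b z) c;
     deriv (fun x => G3 mu h0 m1 m2 x b c) a, deriv (fun y => G3 mu h0 m1 m2 a y c) b,
       deriv (fun z => G3 mu h0 m1 m2 a b z) c]

theorem deriv_cubic_aux (f : ℝ → ℝ) (p q r t x : ℝ)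
    (hf : ∀ y, f y = p + q * y + r * y ^ 2 + t * y ^ 3) :
    deriv f x = q + 2 * r * x + 3 * t * x ^ 2 := by
  have h : HasDerivAt (fun y : ℝ => p + q * y + r * y ^ 2 + t * y ^ 3)
      (q + 2 * r * x + 3 * t * x ^ 2) x := by
    have h1 := (((hasDerivAt_id x).const_mul q).const_add p).add
      (((hasDerivAt_pow 2 x).const_mul r))
    have h2 := h1.add ((hasDerivAt_pow 3 x).const_mul t)
    exact h2.congr_deriv (by norm_num; ring)
  rw [funext hf]
  exact h.deriv

theorem W_stripe_aux (mu h0 m1 m2 s : ℝ) :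
    W mu h0 m1 m2 s 0 0 =
      !![mu - 3 * m1 * s ^ 2, 0, 0;
         0, mu - m2 * s ^ 2, |h0| * s;
         0, |h0| * s, mu - m2 * s ^ 2] := by
  unfold W
  rw [deriv_cubic_aux (fun x => G1 mu h0 m1 m2 x 0 0) 0 mu 0 (-m1) s
      (by intro y; simp only [G1]; ring),
    deriv_cubic_aux (fun y => G1 mu h0 m1 m2 s y 0) (mu * s - m1 * s ^ 3) 0 (-m2 * s) 0 0
      (by intro y; simp only [G1]; ring),
    deriv_cubic_aux (fun z => G1 mu h0 m1 m2 s 0 z) (mu * s - m1 * s ^ 3) 0 (-m2 * s) 0 0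
      (by intro y; simp only [G1]; ring),
    deriv_cubic_aux (fun x => G2 mu h0 m1 m2 x 0 0) 0 0 0 0 s
      (by intro y; simp only [G2]; ring),
    deriv_cubic_aux (fun y => G2 mu h0 m1 m2 s y 0) 0 (mu - m2 * s ^ 2) 0 (-m1) 0
      (by intro y; simp only [G2]; ring),
    deriv_cubic_aux (fun z => G2 mu h0 m1 m2 s 0 z) 0 (|h0| * s) 0 0 0
      (by intro y; simp only [G2]; ring),
    deriv_cubic_aux (fun x => G3 mu h0 m1 m2 x 0 0) 0 0 0 0 s
      (by intro y; simp only [G3]; ring),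
    deriv_cubic_aux (fun y => G3 mu h0 m1 m2 s y 0) 0 (|h0| * s) 0 0 0
      (by intro y; simp only [G3]; ring),
    deriv_cubic_aux (fun z => G3 mu h0 m1 m2 s 0 z) 0 (mu - m2 * s ^ 2) 0 (-m1) 0
      (by intro y; simp only [G3]; ring)]
  ext i j
  fin_cases i <;> fin_cases j <;> simp <;> ring

/-- The stripe point (√(μ/m1), 0, 0) is an equilibrium; the eigenvalues of the
Jacobian there are exactly −2μ, μ(1 − m2/m1) ± |h0|·√(μ/m1), and all three are
negative iff m2 > m1 and μ > h0²·m1/(m2 − m1)². -/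
theorem stripe_equilibrium_stability (mu h0 m1 m2 : ℝ) (hm1 : 0 < m1) (hmu : 0 < mu) :
    (G1 mu h0 m1 m2 (Real.sqrt (mu / m1)) 0 0 = 0 ∧
      G2 mu h0 m1 m2 (Real.sqrt (mu / m1)) 0 0 = 0 ∧
      G3 mu h0 m1 m2 (Real.sqrt (mu / m1)) 0 0 = 0) ∧
    (∀ lam : ℝ,
      Matrix.det (lam • (1 : Matrix (Fin 3) (Fin 3) ℝ)
          - W mu h0 m1 m2 (Real.sqrt (mu / m1)) 0 0) = 0 ↔
        (lam = -2 * mu ∨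
          lam = mu * (1 - m2 / m1) + |h0| * Real.sqrt (mu / m1) ∨
          lam = mu * (1 - m2 / m1) - |h0| * Real.sqrt (mu / m1))) ∧
    ((-2 * mu < 0 ∧
        mu * (1 - m2 / m1) + |h0| * Real.sqrt (mu / m1) < 0 ∧
        mu * (1 - m2 / m1) - |h0| * Real.sqrt (mu / m1) < 0) ↔
      (m1 < m2 ∧ h0 ^ 2 * m1 / (m2 - m1) ^ 2 < mu)) := by
  have hs : 0 < Real.sqrt (mu / m1) := Real.sqrt_pos.mpr (div_pos hmu hm1)
  have hs2 : Real.sqrt (mu / m1) ^ 2 = mu / m1 := Real.sq_sqrt (div_pos hmu hm1).le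
  generalize Real.sqrt (mu / m1) = s at hs hs2 ⊢
  have hmueq : mu = m1 * s ^ 2 := by rw [hs2]; field_simp
  have hA : mu * (1 - m2 / m1) = s ^ 2 * (m1 - m2) := by
    rw [hmueq]; field_simp
  rw [hA]
  have hh : 0 ≤ |h0| := abs_nonneg h0
  have hsq : h0 ^ 2 = |h0| ^ 2 := (sq_abs h0).symm
  rw [hsq]
  refine ⟨⟨?_, ?_, ?_⟩, ?_, ?_⟩
  · simp only [G1]; rw [hmueq]; ring
  · simp only [G2]; ring
  · simp only [G3]; ring
  · intro lam
    have hdet : Matrix.det (lam • (1 : Matrix (Fin 3) (Fin 3) ℝ) - W mu h0 m1 m2 s 0 0)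
        = (lam - (-2 * mu)) * ((lam - (s ^ 2 * (m1 - m2) + |h0| * s)) *
          (lam - (s ^ 2 * (m1 - m2) - |h0| * s))) := by
      rw [W_stripe_aux, Matrix.det_fin_three]
      simp only [Matrix.sub_apply, Matrix.smul_apply, Matrix.one_apply, Matrix.of_apply,
        Matrix.cons_val', Matrix.cons_val_zero, Matrix.cons_val_one, Matrix.cons_val,
        smul_eq_mul]
      simp
      rw [hmueq]
      ring
    rw [hdet, mul_eq_zero, mul_eq_zero, sub_eq_zero, sub_eq_zero, sub_eq_zero]
  · generalize |h0| = h at hh ⊢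
    constructor
    · rintro ⟨-, h1, -⟩
      have h2 : s * (h - s * (m2 - m1)) < 0 := by linarith
      have h3 : h < s * (m2 - m1) := by
        by_contra hc
        have := mul_nonneg hs.le (sub_nonneg.mpr (not_lt.mp hc))
        linarith
      have h4 : 0 < m2 - m1 := pos_of_mul_pos_right (lt_of_le_of_lt hh h3) hs.le
      refine ⟨by linarith, ?_⟩
      rw [div_lt_iff₀ (by positivity), hmueq]
      have h5 : h ^ 2 < (s * (m2 - m1)) ^ 2 := pow_lt_pow_left₀ h3 hh two_ne_zero
      have := mul_lt_mul_of_pos_left h5 hm1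
      linarith
    · rintro ⟨h1, h2⟩
      have h4 : 0 < m2 - m1 := by linarith
      rw [div_lt_iff₀ (by positivity), hmueq] at h2
      have h5 : h ^ 2 < (s * (m2 - m1)) ^ 2 := by
        have : m1 * h ^ 2 < m1 * (s * (m2 - m1)) ^ 2 := by linarith
        exact lt_of_mul_lt_mul_left this hm1.le
      have h3 : h < s * (m2 - m1) := lt_of_pow_lt_pow_left₀ 2 (by positivity) h5
      have h6 := mul_lt_mul_of_pos_left h3 hs
      have h7 := mul_nonneg hh hs.le
      refine ⟨by linarith, by linarith, by linarith⟩
end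

section
/- Suppose m1 + 2m2 > 0, h0 ≠ 0, and −h0²/(4(m1 + 2m2)) < μ < 0, and let ρ⁻ = (|h0| − √(h0² + 4(m1 + 2m2)·μ))/(2(m1 + 2m2)) > 0. Then the Jacobian W of the amplitude system at the hexagonal equilibrium (ρ⁻, ρ⁻, ρ⁻) has the eigenvector (1, 1, 1) with eigenvalue ρ⁻·(|h0| − 2(m1 + 2m2)·ρ⁻), and this eigenvalue is strictly positive; hence the ρ⁻ hexagonal solution is always linearly unstable. -/
/-- Derivative of a cubic, in a form that applies up to a pointwise identity. -/
theorem deriv_cubic (f : ℝ → ℝ) (p q s t x : ℝ)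
    (hf : ∀ y, f y = p + q * y + s * y ^ 2 + t * y ^ 3) :
    deriv f x = q + 2 * s * x + 3 * t * x ^ 2 := by
  have h : f = fun y => p + q * y + s * y ^ 2 + t * y ^ 3 := funext hf
  have h1 := (((hasDerivAt_id x).const_mul q).const_add p).add
    (((hasDerivAt_id x).pow 2).const_mul s)
  have h2 := h1.add (((hasDerivAt_id x).pow 3).const_mul t)
  have h3 : HasDerivAt f (q + 2 * s * x + 3 * t * x ^ 2) x := by
    rw [h]
    refine (h2.congr_deriv ?_)
    simp
    ring
  exact h3.deriv

/-- Diagonal-type partial derivative. -/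
theorem deriv_diag (f : ℝ → ℝ) (mu h m1 m2 r : ℝ)
    (hf : ∀ y, f y = mu * y + h * r * r - m1 * y ^ 3 - m2 * (r ^ 2 + r ^ 2) * y) :
    deriv f r = mu - 2 * m2 * r ^ 2 - 3 * m1 * r ^ 2 := by
  rw [deriv_cubic f (h * r * r) (mu - m2 * (r ^ 2 + r ^ 2)) 0 (-m1) r
    (fun y => by rw [hf]; ring)]
  ring

/-- Off-diagonal-type partial derivative. -/
theorem deriv_offdiag (f : ℝ → ℝ) (mu h m1 m2 r : ℝ)
    (hf : ∀ y, f y = mu * r + h * y * r - m1 * r ^ 3 - m2 * (y ^ 2 + r ^ 2) * r) :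
    deriv f r = h * r - 2 * m2 * r ^ 2 := by
  rw [deriv_cubic f (mu * r - m1 * r ^ 3 - m2 * r ^ 2 * r) (h * r) (-m2 * r) 0 r
    (fun y => by rw [hf]; ring)]
  ring

/-- For −h0²/(4(m1+2m2)) < μ < 0 (with m1 + 2m2 > 0, h0 ≠ 0), the hexagonal
equilibrium ρ⁻ is positive, (1,1,1) is an eigenvector of the Jacobian there with
eigenvalue ρ⁻·(|h0| − 2(m1+2m2)·ρ⁻), and this eigenvalue is strictly positive:
the ρ⁻ hexagonal solution is always linearly unstable. -/
theorem hexagonal_rho_minus_unstable (mu h0 m1 m2 rhoM : ℝ)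
    (hM : 0 < m1 + 2 * m2) (hh : h0 ≠ 0)
    (hmu1 : -h0 ^ 2 / (4 * (m1 + 2 * m2)) < mu) (hmu2 : mu < 0)
    (hrhoM : rhoM = (|h0| - Real.sqrt (h0 ^ 2 + 4 * (m1 + 2 * m2) * mu))
        / (2 * (m1 + 2 * m2))) :
    0 < rhoM ∧
    (W mu h0 m1 m2 rhoM rhoM rhoM).mulVec (fun _ => 1)
      = (rhoM * (|h0| - 2 * (m1 + 2 * m2) * rhoM)) • (fun _ => (1 : ℝ)) ∧
    0 < rhoM * (|h0| - 2 * (m1 + 2 * m2) * rhoM) := by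
  have hD : 0 < h0 ^ 2 + 4 * (m1 + 2 * m2) * mu := by
    rw [div_lt_iff₀ (by positivity)] at hmu1
    linarith
  have hs := Real.sqrt_pos.mpr hD
  have hs2 := Real.sq_sqrt hD.le
  set s := Real.sqrt (h0 ^ 2 + 4 * (m1 + 2 * m2) * mu) with hsdef
  have ha : 0 < |h0| := abs_pos.mpr hh
  have ha2 : |h0| ^ 2 = h0 ^ 2 := sq_abs h0
  have hlt : s < |h0| := by
    have := mul_pos hM (neg_pos.mpr hmu2)
    nlinarith
  have hr : 0 < rhoM := by
    rw [hrhoM]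
    exact div_pos (by linarith) (by linarith)
  have he : 2 * (m1 + 2 * m2) * rhoM = |h0| - s := by
    rw [hrhoM]
    field_simp
  have hq : mu + |h0| * rhoM - (m1 + 2 * m2) * rhoM ^ 2 = 0 := by
    have hsv : s = |h0| - 2 * (m1 + 2 * m2) * rhoM := by linarith
    rw [hsv] at hs2
    have h4 : (4 * (m1 + 2 * m2)) * (mu + |h0| * rhoM - (m1 + 2 * m2) * rhoM ^ 2) = 0 := by
      linear_combination ha2 - hs2
    rcases mul_eq_zero.mp h4 with h | h
    · linarith
    · exact h
  have d11 := deriv_diag (fun x => G1 mu h0 m1 m2 x rhoM rhoM) mu |h0| m1 m2 rhoM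
    (fun y => by unfold G1; ring)
  have d12 := deriv_offdiag (fun y => G1 mu h0 m1 m2 rhoM y rhoM) mu |h0| m1 m2 rhoM
    (fun y => by unfold G1; ring)
  have d13 := deriv_offdiag (fun z => G1 mu h0 m1 m2 rhoM rhoM z) mu |h0| m1 m2 rhoM
    (fun y => by unfold G1; ring)
  have d21 := deriv_offdiag (fun x => G2 mu h0 m1 m2 x rhoM rhoM) mu |h0| m1 m2 rhoM
    (fun y => by unfold G2; ring)
  have d22 := deriv_diag (fun y => G2 mu h0 m1 m2 rhoM y rhoM) mu |h0| m1 m2 rhoM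
    (fun y => by unfold G2; ring)
  have d23 := deriv_offdiag (fun z => G2 mu h0 m1 m2 rhoM rhoM z) mu |h0| m1 m2 rhoM
    (fun y => by unfold G2; ring)
  have d31 := deriv_offdiag (fun x => G3 mu h0 m1 m2 x rhoM rhoM) mu |h0| m1 m2 rhoM
    (fun y => by unfold G3; ring)
  have d32 := deriv_offdiag (fun y => G3 mu h0 m1 m2 rhoM y rhoM) mu |h0| m1 m2 rhoM
    (fun y => by unfold G3; ring)
  have d33 := deriv_diag (fun z => G3 mu h0 m1 m2 rhoM rhoM z) mu |h0| m1 m2 rhoM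
    (fun y => by unfold G3; ring)
  refine ⟨hr, ?_, mul_pos hr (by linarith)⟩
  funext i
  fin_cases i <;>
    simp [W, Matrix.mulVec, dotProduct, Fin.sum_univ_three, d11, d12, d13, d21, d22, d23, d31, d32, d33] <;>
    linear_combination hq
end
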